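/- Fix a real number N > 1 and L > 0. For every ε > 0 there exist w̄ > 0 and δ̄ > 0 such that for all D ≥ 3L, all D' ∈ (0, D], every probability CD(0,N) density h on [0,D'], and every interval set E ⊆ [0, L] with 0 < m_h(E) ≤ w̄ and Res_h^D(E) ≤ δ̄, one has h(x) ≤ h(b(E))·(x/b(E) + ε)^{N−1} for every x ∈ [a(E), b(E)]. -/

import Mathlib

open MeasureTheory
open scoped Classical

noncomputable section

/-- A `CD(0,N)` density on `[0, D']`: nonnegative on `[0, D']`, positive on `(0, D')`,
and `h^{1/(N-1)}` is concave on `[0, D']`. -/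
def IsCDDensity (N D' : ℝ) (h : ℝ → ℝ) : Prop :=
  (∀ x ∈ Set.Icc (0:ℝ) D', 0 ≤ h x) ∧
  (∀ x ∈ Set.Ioo (0:ℝ) D', 0 < h x) ∧
  ConcaveOn ℝ (Set.Icc (0:ℝ) D') (fun x => h x ^ (1 / (N - 1)))

/-- A probability `CD(0,N)` density on `[0, D']`. -/
def IsProbCDDensity (N D' : ℝ) (h : ℝ → ℝ) : Prop :=
  IsCDDensity N D' h ∧ (∫ x in Set.Icc (0:ℝ) D', h x) = 1

/-- A decomposition of an "interval set" `E ⊆ [0, D']`: up to a Lebesgue-null set, `E` is an at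
most countable union of pairwise separated open intervals (degenerate intervals `a i = b i`
are allowed, so that finite families are covered); the summability field expresses that the
perimeter of `E` with respect to the density `h` is a (finite) real number. -/
structure IntervalDecomp (D' : ℝ) (h : ℝ → ℝ) (E : Set ℝ) where
  a : ℕ → ℝ
  b : ℕ → ℝ
  nonneg : ∀ i, 0 ≤ a i
  le : ∀ i, a i ≤ b i
  le_top : ∀ i, b i ≤ D'
  sep : ∀ i j, i ≠ j → b i ≤ a j ∨ b j ≤ a i
  aeEq : E =ᵐ[volume] ⋃ i, Set.Ioo (a i) (b i)
  summablePerim : Summable fun i =>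
    (if a i < b i ∧ a i ≠ 0 then h (a i) else 0) +
    (if a i < b i ∧ b i ≠ D' then h (b i) else 0)

/-- The weighted perimeter `P_h(E) = Σ_{i : a_i ≠ 0} h(a_i) + Σ_{i : b_i ≠ D'} h(b_i)`
of an interval set, computed from a decomposition. -/
def IntervalDecomp.perim {D' : ℝ} {h : ℝ → ℝ} {E : Set ℝ}
    (d : IntervalDecomp D' h E) : ℝ :=
  ∑' i, ((if d.a i < d.b i ∧ d.a i ≠ 0 then h (d.a i) else 0) +
         (if d.a i < d.b i ∧ d.b i ≠ D' then h (d.b i) else 0))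

/-- The essential supremum `b(E)` of a set `E ⊆ ℝ` with respect to Lebesgue measure. -/
def essSupSet (E : Set ℝ) : ℝ :=
  sInf {t : ℝ | volume (E ∩ Set.Ioi t) = 0}

/-- `a = a(E)` is the left endpoint of the right-most connected component of `E`: up to a
Lebesgue-null set, `E = ⋃ i (cᵢ, eᵢ) ∪ (a, b(E))` with `cᵢ, eᵢ < a` for all `i`. -/
def IsRightmostStart (E : Set ℝ) (a : ℝ) : Prop :=
  0 ≤ a ∧ a < essSupSet E ∧
    ∃ c e : ℕ → ℝ, (∀ i, c i ≤ e i ∧ e i < a) ∧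
      E =ᵐ[volume] (((⋃ i, Set.Ioo (c i) (e i)) ∪ Set.Ioo a (essSupSet E) : Set ℝ))

lemma exists_supergrad {D q : ℝ} {f : ℝ → ℝ} (hf : ConcaveOn ℝ (Set.Icc 0 D) f)
    (hq : q ∈ Set.Ioo 0 D) :
    ∃ s : ℝ, ∀ y ∈ Set.Icc 0 D, f y ≤ f q + s * (y - q) := by
  have hD : 0 < D := hq.1.trans hq.2
  have hqI : q ∈ Set.Icc 0 D := ⟨hq.1.le, hq.2.le⟩
  let S : Set ℝ := (fun z => (f z - f q) / (z - q)) '' Set.Ioc q D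
  have key : ∀ x ∈ Set.Ico 0 q, ∀ t ∈ S, t ≤ (f q - f x) / (q - x) := by
    rintro x hx t ⟨z, hz, rfl⟩
    exact hf.slope_anti_adjacent ⟨hx.1, (hx.2.trans hq.2).le⟩ ⟨(hq.1.trans hz.1).le, hz.2⟩ hx.2 hz.1
  have hbdd : BddAbove S := ⟨_, key 0 ⟨le_rfl, hq.1⟩⟩
  have hne : S.Nonempty := ⟨_, D, ⟨hq.2, le_rfl⟩, rfl⟩
  refine ⟨sSup S, fun y hy => ?_⟩
  rcases lt_trichotomy y q with h | h | h
  · have h1 : sSup S ≤ (f q - f y) / (q - y) := csSup_le hne (key y ⟨hy.1, h⟩)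
    rw [le_div_iff₀ (by linarith)] at h1
    linarith
  · subst h; simp
  · have h1 : (f y - f q) / (y - q) ≤ sSup S := le_csSup hbdd ⟨y, ⟨h, hy.2⟩, rfl⟩
    rw [div_le_iff₀ (by linarith)] at h1
    linarith

lemma line_integral {N s : ℝ} (hN : 1 < N) (hs : s ≠ 0) (c u v : ℝ) :
    ∫ y in u..v, (c + s * y) ^ (N - 1) = ((c + s * v) ^ N - (c + s * u) ^ N) / (N * s) := by
  have hN0 : N ≠ 0 := by linarith
  have : ∀ y ∈ Set.uIcc u v, HasDerivAt (fun y => (c + s * y) ^ N / (N * s))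
      ((c + s * y) ^ (N - 1)) y := by
    intro y _
    have h1 : HasDerivAt (fun y => c + s * y) s y := by
      simpa using ((hasDerivAt_id y).const_mul s).const_add c
    have h2 := (h1.rpow_const (p := N) (Or.inr hN.le)).div_const (N * s)
    exact h2.congr_deriv (by field_simp)
  rw [intervalIntegral.integral_eq_sub_of_hasDerivAt this]
  · ring
  · apply Continuous.intervalIntegrable
    exact (by fun_prop : Continuous fun y => c + s * y).rpow_const (fun _ => Or.inr (by linarith))

/-- the purely numerical part -/
lemma core_num {N D β s ε ρ κ m : ℝ} (hN : 1 < N) (hD : 0 < D) (hβ : 0 < β) (hs : 0 < s)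
    (hε0 : 0 ≤ ε) (hε1 : ε < 1) (hρ : 0 < ρ) (hκ : 0 < κ)
    (hρκ : (1 + ρ) ^ N ≤ (1 + κ) ^ N * (1 - ρ))
    (hm0 : 0 ≤ m) (hβs : β ≤ ρ * (s * D)) (hβD : β ^ (N - 1) * D ≤ 1)
    (hm1 : m ≤ β ^ N * (1 - ε ^ N) / (N * s))
    (hm2 : 1 - m ≤ (β + s * D) ^ N / (N * s)) :
    m ^ (1 - 1 / N) ≤ (1 - ε ^ N) ^ (1 - 1 / N) * (1 + κ) * (D / N * β ^ (N - 1)) := by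
  have hN0 : 0 < N := by linarith
  have hεN : 0 ≤ ε ^ N := Real.rpow_nonneg hε0 _
  have hεN1 : ε ^ N < 1 := Real.rpow_lt_one hε0 hε1 hN0
  have hβN : β ^ N = β ^ (N - 1) * β := by
    rw [← Real.rpow_add_one hβ.ne']; ring_nf
  have hsN : s ^ N = s ^ (N - 1) * s := by
    rw [← Real.rpow_add_one hs.ne']; ring_nf
  have hβp : 0 < β ^ (N - 1) := Real.rpow_pos_of_pos hβ _
  have hsp : 0 < s ^ (N - 1) := Real.rpow_pos_of_pos hs _
  have hDp : 0 < D ^ N := Real.rpow_pos_of_pos hD _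
  -- m ≤ ρ
  have hmρ : m ≤ ρ := by
    refine hm1.trans ?_
    rw [div_le_iff₀ (by positivity), hβN]
    have h1 : β ^ (N - 1) * β * (1 - ε ^ N) ≤ β ^ (N - 1) * β * 1 := by
      apply mul_le_mul_of_nonneg_left (by linarith) (by positivity)
    have h2 : β ^ (N - 1) * β ≤ β ^ (N - 1) * (ρ * (s * D)) :=
      mul_le_mul_of_nonneg_left hβs hβp.le
    have h3 : β ^ (N - 1) * D * (ρ * s) ≤ 1 * (ρ * s) :=
      mul_le_mul_of_nonneg_right hβD (by positivity)
    have h4 : 1 * (ρ * s) ≤ N * (ρ * s) := mul_le_mul_of_nonneg_right hN.le (by positivity)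
    nlinarith
  have h5 : (β + s * D) ^ N ≤ (1 + ρ) ^ N * (s ^ N * D ^ N) := by
    rw [← Real.mul_rpow hs.le hD.le, ← Real.mul_rpow (by positivity) (by positivity)]
    apply Real.rpow_le_rpow (by positivity) _ hN0.le
    linarith
  have h6 : (1 - ρ) * N ≤ (1 + ρ) ^ N * (s ^ (N - 1) * D ^ N) := by
    have h7 : 1 - ρ ≤ (1 + ρ) ^ N * (s ^ N * D ^ N) / (N * s) := by
      refine (by linarith : 1 - ρ ≤ 1 - m).trans (hm2.trans ?_)
      gcongr
    rw [le_div_iff₀ (by positivity), hsN] at h7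
    have : (1 - ρ) * N * s ≤ (1 + ρ) ^ N * (s ^ (N - 1) * D ^ N) * s := by linarith
    exact le_of_mul_le_mul_right this hs
  have h1ρ : 0 < 1 - ρ := by
    have : 0 < (1 + κ) ^ N * (1 - ρ) := lt_of_lt_of_le (by positivity) hρκ
    exact pos_of_mul_pos_right this (by positivity)
  have h8 : N ≤ (1 + κ) ^ N * (s ^ (N - 1) * D ^ N) := by
    have : (1 - ρ) * N ≤ (1 - ρ) * ((1 + κ) ^ N * (s ^ (N - 1) * D ^ N)) := by
      refine h6.trans ?_
      have := mul_le_mul_of_nonneg_right hρκ (by positivity : 0 ≤ s ^ (N - 1) * D ^ N)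
      linarith
    exact le_of_mul_le_mul_left this h1ρ
  -- (N s)^{θ} (1+κ) D ≥ N
  set θ := 1 - 1 / N with hθ
  have hθN : N * θ = N - 1 := by rw [hθ]; field_simp
  have hθ0 : 0 < θ := by
    have : 0 < N * θ := by rw [hθN]; linarith
    exact pos_of_mul_pos_right this hN0.le
  have h9 : N ≤ (N * s) ^ θ * ((1 + κ) * D) := by
    have h10 : N ^ N ≤ ((N * s) ^ θ * ((1 + κ) * D)) ^ N := by
      rw [Real.mul_rpow (by positivity) (by positivity), ← Real.rpow_mul (by positivity),
        mul_comm θ N, hθN, Real.mul_rpow hN0.le hs.le, Real.mul_rpow (by positivity) hD.le]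
      have : N ^ N = N ^ (N - 1) * N := by
        rw [← Real.rpow_add_one hN0.ne']; ring_nf
      rw [this]
      have := mul_le_mul_of_nonneg_left h8 (by positivity : 0 ≤ N ^ (N - 1))
      linarith
    exact (Real.rpow_le_rpow_iff hN0.le (by positivity) hN0).1 h10
  have hβθ : (β ^ N) ^ θ = β ^ (N - 1) := by
    rw [← Real.rpow_mul hβ.le, hθN]
  calc m ^ θ ≤ (β ^ N * (1 - ε ^ N) / (N * s)) ^ θ := Real.rpow_le_rpow hm0 hm1 hθ0.le
    _ = β ^ (N - 1) * (1 - ε ^ N) ^ θ / (N * s) ^ θ := by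
        rw [Real.div_rpow (mul_nonneg (by positivity) (by linarith)) (by positivity),
          Real.mul_rpow (by positivity) (by linarith), hβθ]
    _ ≤ _ := by
        rw [div_le_iff₀ (by positivity)]
        have h11 : 0 ≤ (1 - ε ^ N) ^ θ := Real.rpow_nonneg (by linarith) _
        have h12 : 1 ≤ (N * s) ^ θ * ((1 + κ) * D) / N := by
          rw [le_div_iff₀ hN0]; linarith
        calc β ^ (N - 1) * (1 - ε ^ N) ^ θ = β ^ (N - 1) * (1 - ε ^ N) ^ θ * 1 := by ring
          _ ≤ β ^ (N - 1) * (1 - ε ^ N) ^ θ * ((N * s) ^ θ * ((1 + κ) * D) / N) := by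
              gcongr
          _ = _ := by ring

lemma IsProbCDDensity.integrableOn {N D : ℝ} {h : ℝ → ℝ} (hh : IsProbCDDensity N D h) :
    IntegrableOn h (Set.Icc 0 D) := by
  by_contra hc
  have := hh.2
  rw [integral_undef hc] at this
  norm_num at this

lemma IsProbCDDensity.intervalIntegrable {N D : ℝ} {h : ℝ → ℝ} (hh : IsProbCDDensity N D h)
    {u v : ℝ} (hu : 0 ≤ u) (huv : u ≤ v) (hv : v ≤ D) : IntervalIntegrable h volume u v := by
  rw [intervalIntegrable_iff_integrableOn_Icc_of_le huv]
  exact hh.integrableOn.mono_set (Set.Icc_subset_Icc hu hv)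

lemma IsProbCDDensity.integral_eq_one {N D : ℝ} {h : ℝ → ℝ} (hh : IsProbCDDensity N D h)
    (hD : 0 ≤ D) : ∫ y in (0 : ℝ)..D, h y = 1 := by
  rw [intervalIntegral.integral_of_le hD, ← integral_Icc_eq_integral_Ioc, hh.2]

lemma IsProbCDDensity.integral_nonneg {N D : ℝ} {h : ℝ → ℝ} (hh : IsProbCDDensity N D h)
    {u v : ℝ} (hu : 0 ≤ u) (huv : u ≤ v) (hv : v ≤ D) : 0 ≤ ∫ y in u..v, h y :=
  intervalIntegral.integral_nonneg huv fun y hy => hh.1.1 y ⟨hu.trans hy.1, hy.2.trans hv⟩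

lemma IsCDDensity.pow_eq {N D : ℝ} {h : ℝ → ℝ} (hN : 1 < N) (hh : IsCDDensity N D h)
    {y : ℝ} (hy : y ∈ Set.Icc 0 D) : h y = (h y ^ (1 / (N - 1))) ^ (N - 1) := by
  rw [← Real.rpow_mul (hh.1 y hy), one_div, inv_mul_cancel₀ (by linarith), Real.rpow_one]

lemma half_left {N D q ε ρ κ : ℝ} {h : ℝ → ℝ} (hN : 1 < N)
    (hh : IsProbCDDensity N D h) (hq : q ∈ Set.Ioo 0 D)
    (hε0 : 0 ≤ ε) (hε1 : ε < 1) (hρ : 0 < ρ) (hκ : 0 < κ)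
    (hρκ : (1 + ρ) ^ N ≤ (1 + κ) ^ N * (1 - ρ))
    (hsg : ∀ s : ℝ, (∀ y ∈ Set.Icc 0 D,
      h y ^ (1 / (N - 1)) ≤ h q ^ (1 / (N - 1)) + s * (y - q)) →
      ε * h q ^ (1 / (N - 1)) ≤ h q ^ (1 / (N - 1)) - s * q)
    (hm : ∫ y in (0 : ℝ)..q, h y ≤ 2 / 3)
    (hη : h q * D ≤ 1 / 3 * (ρ / (1 + ρ)) ^ (N - 1)) :
    (∫ y in (0 : ℝ)..q, h y) ^ (1 - 1 / N) ≤
      (1 - ε ^ N) ^ (1 - 1 / N) * (1 + κ) * (D / N * h q) := by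
  have hD : 0 < D := hq.1.trans hq.2
  have hN0 : 0 < N := by linarith
  have hN1 : 0 < N - 1 := by linarith
  have hqI : q ∈ Set.Icc 0 D := ⟨hq.1.le, hq.2.le⟩
  obtain ⟨s, hs⟩ := exists_supergrad hh.1.2.2 hq
  have hεs := hsg s hs
  have hhq := IsCDDensity.pow_eq hN hh.1 hqI
  set β := h q ^ (1 / (N - 1)) with hβdef
  have hβ : 0 < β := Real.rpow_pos_of_pos (hh.1.2.1 q hq) _
  have hle : ∀ y ∈ Set.Icc 0 D, h y ≤ ((β - s * q) + s * y) ^ (N - 1) := by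
    intro y hy
    rw [IsCDDensity.pow_eq hN hh.1 hy]
    refine Real.rpow_le_rpow (Real.rpow_nonneg (hh.1.1 y hy) _) ?_ hN1.le
    have := hs y hy
    linarith
  have hfnn : ∀ y ∈ Set.Icc 0 D, 0 ≤ (β - s * q) + s * y := by
    intro y hy
    have := hs y hy
    have h2 := Real.rpow_nonneg (hh.1.1 y hy) (1 / (N - 1))
    linarith
  have hm0 := hh.integral_nonneg le_rfl hq.1.le hq.2.le
  have hsum : (∫ y in (0 : ℝ)..q, h y) + ∫ y in q..D, h y = 1 := by
    rw [intervalIntegral.integral_add_adjacent_intervals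
      (hh.intervalIntegrable le_rfl hq.1.le hq.2.le) (hh.intervalIntegrable hq.1.le hq.2.le le_rfl),
      hh.integral_eq_one hD.le]
  have hcont : Continuous fun y => ((β - s * q) + s * y) ^ (N - 1) :=
    (by fun_prop : Continuous fun y => (β - s * q) + s * y).rpow_const
      (fun _ => Or.inr (by linarith))
  have hm1 : ∫ y in (0 : ℝ)..q, h y ≤ ∫ y in (0 : ℝ)..q, ((β - s * q) + s * y) ^ (N - 1) :=
    intervalIntegral.integral_mono_on hq.1.le (hh.intervalIntegrable le_rfl hq.1.le hq.2.le)
      (hcont.intervalIntegrable _ _) fun y hy => hle y ⟨hy.1, hy.2.trans hq.2.le⟩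
  have hm2 : ∫ y in q..D, h y ≤ ∫ y in q..D, ((β - s * q) + s * y) ^ (N - 1) :=
    intervalIntegral.integral_mono_on hq.2.le (hh.intervalIntegrable hq.1.le hq.2.le le_rfl)
      (hcont.intervalIntegrable _ _) fun y hy => hle y ⟨hq.1.le.trans hy.1, hy.2⟩
  have hr1 : ρ / (1 + ρ) < 1 := by rw [div_lt_one (by linarith)]; linarith
  have hr0 : 0 < ρ / (1 + ρ) := by positivity
  have hrN : (ρ / (1 + ρ)) ^ (N - 1) < 1 := Real.rpow_lt_one hr0.le hr1 hN1
  -- crude bounds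
  have hcr : ∀ M : ℝ, 0 ≤ M → (∀ y ∈ Set.Icc q D, (β - s * q) + s * y ≤ M) →
      1 / 3 ≤ D * M ^ (N - 1) := by
    intro M hM0 hM
    have h1 : ∫ y in q..D, h y ≤ ∫ y in q..D, M ^ (N - 1) :=
      intervalIntegral.integral_mono_on hq.2.le (hh.intervalIntegrable hq.1.le hq.2.le le_rfl)
        (by simp) fun y hy => (hle y ⟨hq.1.le.trans hy.1, hy.2⟩).trans
          (Real.rpow_le_rpow (hfnn y ⟨hq.1.le.trans hy.1, hy.2⟩) (hM y hy) hN1.le)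
    rw [intervalIntegral.integral_const, smul_eq_mul] at h1
    have h2 : (D - q) * M ^ (N - 1) ≤ D * M ^ (N - 1) :=
      mul_le_mul_of_nonneg_right (by linarith [hq.1]) (Real.rpow_nonneg hM0 _)
    linarith
  have hspos : 0 < s := by
    by_contra hs0
    push Not at hs0
    have := hcr β hβ.le (fun y hy => by nlinarith [hy.1])
    rw [← hhq] at this
    linarith
  have hβs : β ≤ ρ * (s * D) := by
    have h1 := hcr (β + s * D) (by positivity) (fun y hy => by nlinarith [hy.2, hq.1])
    have h2 : β ^ (N - 1) ≤ (ρ / (1 + ρ) * (β + s * D)) ^ (N - 1) := by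
      rw [Real.mul_rpow hr0.le (by positivity)]
      rw [hhq] at hη
      have h3 := mul_le_mul_of_nonneg_right h1 (Real.rpow_nonneg hr0.le (N - 1))
      have : β ^ (N - 1) * D ≤ (ρ / (1 + ρ)) ^ (N - 1) * (β + s * D) ^ (N - 1) * D := by linarith
      exact le_of_mul_le_mul_right this hD
    have h3 := (Real.rpow_le_rpow_iff hβ.le (by positivity) hN1).1 h2
    rw [div_mul_eq_mul_div, le_div_iff₀ (by linarith)] at h3
    linarith
  rw [line_integral hN hspos.ne'] at hm1 hm2
  rw [hhq]
  refine core_num hN hD hβ hspos hε0 hε1 hρ hκ hρκ hm0 hβs ?_ ?_ ?_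
  · rw [← hhq]; linarith
  · refine hm1.trans ?_
    gcongr
    have e1 : β - s * q + s * q = β := by ring
    have e2 : ε ^ N * β ^ N ≤ (β - s * q + s * 0) ^ N := by
      rw [← Real.mul_rpow hε0 hβ.le]
      exact Real.rpow_le_rpow (by positivity) (by linarith) hN0.le
    rw [e1]; linarith
  · have : 1 - ∫ y in (0 : ℝ)..q, h y = ∫ y in q..D, h y := by linarith
    rw [this]
    refine hm2.trans ?_
    gcongr
    have e1 : β - s * q + s * q = β := by ring
    rw [e1]
    have e2 : (β - s * q + s * D) ^ N ≤ (β + s * D) ^ N :=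
      Real.rpow_le_rpow (hfnn D ⟨hD.le, le_rfl⟩) (by nlinarith [hq.1]) hN0.le
    have : 0 ≤ β ^ N := by positivity
    linarith

/-- The crude left version. -/
lemma half_left0 {N D q ρ κ : ℝ} {h : ℝ → ℝ} (hN : 1 < N)
    (hh : IsProbCDDensity N D h) (hq : q ∈ Set.Ioo 0 D) (hρ : 0 < ρ) (hκ : 0 < κ)
    (hρκ : (1 + ρ) ^ N ≤ (1 + κ) ^ N * (1 - ρ))
    (hm : ∫ y in (0 : ℝ)..q, h y ≤ 2 / 3)
    (hη : h q * D ≤ 1 / 3 * (ρ / (1 + ρ)) ^ (N - 1)) :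
    (∫ y in (0 : ℝ)..q, h y) ^ (1 - 1 / N) ≤ (1 + κ) * (D / N * h q) := by
  have := half_left (ε := 0) hN hh hq le_rfl one_pos hρ hκ hρκ ?_ hm hη
  · rwa [Real.zero_rpow (by linarith), sub_zero, Real.one_rpow, one_mul] at this
  · intro s hs
    have h1 := hs 0 ⟨le_rfl, (hq.1.trans hq.2).le⟩
    have h2 := Real.rpow_nonneg (hh.1.1 0 ⟨le_rfl, (hq.1.trans hq.2).le⟩) (1 / (N - 1))
    linarith

lemma IsProbCDDensity.reflect {N D : ℝ} {h : ℝ → ℝ} (hD : 0 < D) (hh : IsProbCDDensity N D h) :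
    IsProbCDDensity N D (fun x => h (D - x)) := by
  refine ⟨⟨fun x hx => hh.1.1 _ ⟨by linarith [hx.2], by linarith [hx.1]⟩,
    fun x hx => hh.1.2.1 _ ⟨by linarith [hx.2], by linarith [hx.1]⟩, ?_⟩, ?_⟩
  · refine ⟨convex_Icc _ _, fun x hx y hy a b ha hb hab => ?_⟩
    have := hh.1.2.2.2 (x := D - x) (y := D - y) ⟨by linarith [hx.2], by linarith [hx.1]⟩
      ⟨by linarith [hy.2], by linarith [hy.1]⟩ ha hb hab
    have e : a • (D - x) + b • (D - y) = D - (a • x + b • y) := by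
      simp only [smul_eq_mul]
      linear_combination D * hab
    rw [e] at this
    exact this
  · rw [integral_Icc_eq_integral_Ioc, ← intervalIntegral.integral_of_le hD.le,
      intervalIntegral.integral_comp_sub_left]
    simpa using hh.integral_eq_one hD.le

lemma half_right0 {N D p ρ κ : ℝ} {h : ℝ → ℝ} (hN : 1 < N)
    (hh : IsProbCDDensity N D h) (hp : p ∈ Set.Ioo 0 D) (hρ : 0 < ρ) (hκ : 0 < κ)
    (hρκ : (1 + ρ) ^ N ≤ (1 + κ) ^ N * (1 - ρ))
    (hm : ∫ y in p..D, h y ≤ 2 / 3)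
    (hη : h p * D ≤ 1 / 3 * (ρ / (1 + ρ)) ^ (N - 1)) :
    (∫ y in p..D, h y) ^ (1 - 1 / N) ≤ (1 + κ) * (D / N * h p) := by
  have hD := hp.1.trans hp.2
  have e : ∫ y in (0 : ℝ)..(D - p), h (D - y) = ∫ y in p..D, h y := by
    rw [intervalIntegral.integral_comp_sub_left]; simp
  have := half_left0 (q := D - p) hN (hh.reflect hD)
    ⟨by linarith [hp.2], by linarith [hp.1]⟩ hρ hκ hρκ
    (by rw [e]; exact hm) (by simpa using hη)
  rw [e] at this
  simpa using this

/-- Isoperimetric inequality for one component. -/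
lemma comp_iso {N D p q ρ κ P : ℝ} {h : ℝ → ℝ} (hN : 1 < N) (hD : 0 < D)
    (hh : IsProbCDDensity N D h) (hp : 0 ≤ p) (hpq : p < q) (hq : q ≤ D)
    (hρ : 0 < ρ) (hκ : 0 < κ)
    (hρκ : (1 + ρ) ^ N ≤ (1 + κ) ^ N * (1 - ρ))
    (hw : ∫ y in p..q, h y ≤ 1 / 6)
    (hPp : p ≠ 0 → h p ≤ P) (hPq : q ≠ D → h q ≤ P)
    (hη : P * D ≤ 1 / 3 * (ρ / (1 + ρ)) ^ (N - 1)) :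
    (∫ y in p..q, h y) ^ (1 - 1 / N) ≤ (1 + κ) * (D / N) *
      ((if p ≠ 0 then h p else 0) + (if q ≠ D then h q else 0)) := by
  have hN0 : 0 < N := by linarith
  have hθ : 0 ≤ 1 - 1 / N := by
    rw [sub_nonneg, div_le_one hN0]; exact hN.le
  have hpD : p ≤ D := hpq.le.trans hq
  have hq0 : 0 ≤ q := hp.trans hpq.le
  have i1 := hh.intervalIntegrable le_rfl hp hpD
  have i2 := hh.intervalIntegrable hp hpq.le hq
  have i3 := hh.intervalIntegrable hq0 hq le_rfl
  have s1 := intervalIntegral.integral_add_adjacent_intervals i1 i2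
  have s2 := intervalIntegral.integral_add_adjacent_intervals i2 i3
  have s3 := intervalIntegral.integral_add_adjacent_intervals i1
    (hh.intervalIntegrable hp hpD le_rfl)
  rw [hh.integral_eq_one hD.le] at s3
  have n1 := hh.integral_nonneg le_rfl hp hpD
  have n2 := hh.integral_nonneg hp hpq.le hq
  have n3 := hh.integral_nonneg hq0 hq le_rfl
  have k1 : 0 ≤ (if p ≠ 0 then h p else 0) := by
    split_ifs
    · exact hh.1.1 p ⟨hp, hpD⟩
    · exact le_rfl
  have k2 : 0 ≤ (if q ≠ D then h q else 0) := by
    split_ifs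
    · exact hh.1.1 q ⟨hq0, hq⟩
    · exact le_rfl
  have hC : 0 ≤ (1 + κ) * (D / N) := by positivity
  by_cases hc : ∫ y in (0 : ℝ)..p, h y ≤ 1 / 2
  · have hqD : q ≠ D := by
      rintro rfl
      simp only [intervalIntegral.integral_same] at s2
      linarith
    have := half_left0 hN hh ⟨hp.trans_lt hpq, lt_of_le_of_ne hq hqD⟩ hρ hκ hρκ (by linarith)
      ((mul_le_mul_of_nonneg_right (hPq hqD) hD.le).trans hη)
    rw [if_pos hqD] at *
    calc (∫ y in p..q, h y) ^ (1 - 1 / N) ≤ (∫ y in (0 : ℝ)..q, h y) ^ (1 - 1 / N) :=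
          Real.rpow_le_rpow n2 (by linarith) hθ
      _ ≤ (1 + κ) * (D / N) * h q := by linarith
      _ ≤ _ := mul_le_mul_of_nonneg_left (by linarith) hC
  · push Not at hc
    have hp0 : p ≠ 0 := by
      rintro rfl
      simp only [intervalIntegral.integral_same] at hc
      linarith
    have := half_right0 hN hh ⟨lt_of_le_of_ne hp hp0.symm, hpq.trans_le hq⟩ hρ hκ hρκ
      (by linarith) ((mul_le_mul_of_nonneg_right (hPp hp0) hD.le).trans hη)
    rw [if_pos hp0] at *
    calc (∫ y in p..q, h y) ^ (1 - 1 / N) ≤ (∫ y in p..D, h y) ^ (1 - 1 / N) :=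
          Real.rpow_le_rpow n2 (by linarith) hθ
      _ ≤ (1 + κ) * (D / N) * h p := by linarith
      _ ≤ _ := mul_le_mul_of_nonneg_left (by linarith) hC

lemma perim_term_nonneg {N D : ℝ} {h : ℝ → ℝ} {E : Set ℝ} (hh : IsProbCDDensity N D h)
    (d : IntervalDecomp D h E) (i : ℕ) :
    0 ≤ (if d.a i < d.b i ∧ d.a i ≠ 0 then h (d.a i) else 0) ∧
    0 ≤ (if d.a i < d.b i ∧ d.b i ≠ D then h (d.b i) else 0) := by
  constructor
  · split_ifs
    · exact hh.1.1 _ ⟨d.nonneg i, (d.le i).trans (d.le_top i)⟩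
    · exact le_rfl
  · split_ifs
    · exact hh.1.1 _ ⟨(d.nonneg i).trans (d.le i), d.le_top i⟩
    · exact le_rfl

lemma perim_term_le {N D : ℝ} {h : ℝ → ℝ} {E : Set ℝ} (hh : IsProbCDDensity N D h)
    (d : IntervalDecomp D h E) (i : ℕ) :
    (if d.a i < d.b i ∧ d.a i ≠ 0 then h (d.a i) else 0) +
    (if d.a i < d.b i ∧ d.b i ≠ D then h (d.b i) else 0) ≤ d.perim :=
  d.summablePerim.le_tsum i fun j _ =>
    add_nonneg (perim_term_nonneg hh d j).1 (perim_term_nonneg hh d j).2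

lemma left_le_perim {N D : ℝ} {h : ℝ → ℝ} {E : Set ℝ} (hh : IsProbCDDensity N D h)
    (d : IntervalDecomp D h E) (i : ℕ) (hi : d.a i < d.b i) (h0 : d.a i ≠ 0) :
    h (d.a i) ≤ d.perim := by
  have h1 := perim_term_le hh d i
  have h2 := (perim_term_nonneg hh d i).2
  rw [if_pos ⟨hi, h0⟩] at h1
  linarith

lemma right_le_perim {N D : ℝ} {h : ℝ → ℝ} {E : Set ℝ} (hh : IsProbCDDensity N D h)
    (d : IntervalDecomp D h E) (i : ℕ) (hi : d.a i < d.b i) (h0 : d.b i ≠ D) :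
    h (d.b i) ≤ d.perim := by
  have h1 := perim_term_le hh d i
  have h2 := (perim_term_nonneg hh d i).1
  rw [if_pos (c := d.a i < d.b i ∧ d.b i ≠ D) ⟨hi, h0⟩] at h1
  linarith

lemma mass_hasSum {N D : ℝ} {h : ℝ → ℝ} {E : Set ℝ} (hh : IsProbCDDensity N D h)
    (d : IntervalDecomp D h E) :
    HasSum (fun i => ∫ y in (d.a i)..(d.b i), h y) (∫ x in E, h x) := by
  rw [setIntegral_congr_set d.aeEq]
  have e : (fun i => ∫ y in (d.a i)..(d.b i), h y) =
      fun i => ∫ y in Set.Ioo (d.a i) (d.b i), h y := by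
    funext i
    rw [intervalIntegral.integral_of_le (d.le i), integral_Ioc_eq_integral_Ioo]
  rw [e]
  refine hasSum_integral_iUnion (fun i => measurableSet_Ioo) ?_ ?_
  · intro i j hij
    refine Set.disjoint_left.2 fun x hx hy => ?_
    rcases d.sep i j hij with h1 | h1
    · linarith [hx.2, hy.1]
    · linarith [hx.1, hy.2]
  · refine hh.integrableOn.mono_set (Set.iUnion_subset fun i x hx => ?_)
    exact ⟨(d.nonneg i).trans hx.1.le, hx.2.le.trans (d.le_top i)⟩

lemma set_iso {N D ρ κ : ℝ} {h : ℝ → ℝ} {E : Set ℝ} (hN : 1 < N) (hD : 0 < D)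
    (hh : IsProbCDDensity N D h) (d : IntervalDecomp D h E)
    (hρ : 0 < ρ) (hκ : 0 < κ) (hρκ : (1 + ρ) ^ N ≤ (1 + κ) ^ N * (1 - ρ))
    (hw0 : 0 < ∫ x in E, h x) (hw : ∫ x in E, h x ≤ 1 / 6)
    (hη : d.perim * D ≤ 1 / 3 * (ρ / (1 + ρ)) ^ (N - 1)) :
    (∫ x in E, h x) ^ (1 - 1 / N) ≤ (1 + κ) * (D / N) * d.perim := by
  have hN0 : 0 < N := by linarith
  have hθ : 0 < 1 - 1 / N := by
    rw [sub_pos, div_lt_one hN0]; exact hN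
  have hS := mass_hasSum hh d
  set w := ∫ x in E, h x with hwdef
  have hmn : ∀ i, 0 ≤ ∫ y in (d.a i)..(d.b i), h y := fun i =>
    hh.integral_nonneg (d.nonneg i) (d.le i) (d.le_top i)
  have hmw : ∀ i, ∫ y in (d.a i)..(d.b i), h y ≤ w := fun i =>
    le_hasSum hS i fun j _ => hmn j
  have hsplit : ∀ t : ℝ, 0 < t → t = t ^ (1 - 1 / N) * t ^ (1 / N) := fun t ht => by
    rw [← Real.rpow_add ht, sub_add_cancel, Real.rpow_one]
  have hwN : 0 < w ^ (1 / N) := Real.rpow_pos_of_pos hw0 _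
  have hterm : ∀ i, ∫ y in (d.a i)..(d.b i), h y ≤ w ^ (1 / N) * ((1 + κ) * (D / N)) *
      ((if d.a i < d.b i ∧ d.a i ≠ 0 then h (d.a i) else 0) +
        (if d.a i < d.b i ∧ d.b i ≠ D then h (d.b i) else 0)) := by
    intro i
    have hn := perim_term_nonneg hh d i
    rcases (d.le i).lt_or_eq with hi | hi
    · have := comp_iso hN hD hh (d.nonneg i) hi (d.le_top i) hρ hκ hρκ ((hmw i).trans hw)
        (left_le_perim hh d i hi) (right_le_perim hh d i hi) hη
      rcases (hmn i).lt_or_eq with hm | hm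
      · rw [hsplit _ hm]
        have h2 : (∫ y in (d.a i)..(d.b i), h y) ^ (1 / N) ≤ w ^ (1 / N) :=
          Real.rpow_le_rpow hm.le (hmw i) (by positivity)
        simp only [hi, true_and]
        calc _ ≤ (1 + κ) * (D / N) * ((if d.a i ≠ 0 then h (d.a i) else 0) +
              (if d.b i ≠ D then h (d.b i) else 0)) * w ^ (1 / N) :=
              mul_le_mul this h2 (by positivity)
                ((Real.rpow_nonneg hm.le _).trans this)
          _ = _ := by ring
      · rw [← hm]
        exact mul_nonneg (by positivity) (add_nonneg hn.1 hn.2)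
    · rw [hi]; simp
  have h1 : w ≤ w ^ (1 / N) * ((1 + κ) * (D / N)) * d.perim := by
    have h2 := d.summablePerim.hasSum.mul_left (w ^ (1 / N) * ((1 + κ) * (D / N)))
    exact hasSum_le hterm hS h2
  have h3 : w ^ (1 - 1 / N) * w ^ (1 / N) ≤ (1 + κ) * (D / N) * d.perim * w ^ (1 / N) := by
    rw [← hsplit w hw0]; linarith
  exact le_of_mul_le_mul_right h3 hwN

lemma essSup_facts {N D L : ℝ} {h : ℝ → ℝ} {E : Set ℝ} (hE : E ⊆ Set.Icc 0 L)
    (d : IntervalDecomp D h E) (hw0 : 0 < ∫ x in E, h x) :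
    essSupSet E ≤ L ∧ (∀ i, d.a i < d.b i → d.b i ≤ essSupSet E) ∧
    (∀ t < essSupSet E, ∃ i, d.a i < d.b i ∧ t < d.b i) := by
  have hbdd : BddBelow {t : ℝ | volume (E ∩ Set.Ioi t) = 0} := by
    refine ⟨0, fun t ht => ?_⟩
    by_contra hc
    push Not at hc
    have : E ∩ Set.Ioi t = E := Set.inter_eq_left.2 fun x hx => hc.trans_le (hE hx).1
    simp only [Set.mem_setOf_eq, this] at ht
    rw [Measure.restrict_eq_zero.2 ht] at hw0
    simp at hw0
  have hLS : L ∈ {t : ℝ | volume (E ∩ Set.Ioi t) = 0} := by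
    have : E ∩ Set.Ioi L = ∅ := by
      ext x
      simp only [Set.mem_inter_iff, Set.mem_Ioi, Set.mem_empty_iff_false, iff_false, not_and, not_lt]
      exact fun hx => (hE hx).2
    simp [this]
  have hae : ∀ t, volume (E ∩ Set.Ioi t) = volume ((⋃ i, Set.Ioo (d.a i) (d.b i)) ∩ Set.Ioi t) :=
    fun t => measure_congr (d.aeEq.inter (Filter.EventuallyEq.refl _ _))
  refine ⟨csInf_le hbdd hLS, fun i hi => ?_, fun t ht => ?_⟩
  · by_contra hc
    push Not at hc
    obtain ⟨t, ht, htb⟩ := exists_lt_of_csInf_lt ⟨L, hLS⟩ hc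
    simp only [Set.mem_setOf_eq, hae] at ht
    have hsub : Set.Ioo (max (d.a i) t) (d.b i) ⊆ (⋃ i, Set.Ioo (d.a i) (d.b i)) ∩ Set.Ioi t := by
      intro x hx
      refine ⟨Set.mem_iUnion.2 ⟨i, (le_max_left _ _).trans_lt hx.1, hx.2⟩,
        (le_max_right _ _).trans_lt hx.1⟩
    have := measure_mono_null hsub ht
    rw [Real.volume_Ioo, ENNReal.ofReal_eq_zero, sub_nonpos] at this
    exact absurd (max_lt hi htb) (not_lt.2 this)
  · have hn : volume (E ∩ Set.Ioi t) ≠ 0 := fun hc => absurd (csInf_le hbdd hc) (not_le.2 ht)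
    rw [hae] at hn
    obtain ⟨x, hx, hxt⟩ := nonempty_of_measure_ne_zero hn
    obtain ⟨i, hi⟩ := Set.mem_iUnion.1 hx
    exact ⟨i, hi.1.trans hi.2, lt_trans hxt hi.2⟩

lemma IsCDDensity.continuousAt {N D b : ℝ} {h : ℝ → ℝ} (hN : 1 < N) (hh : IsCDDensity N D h)
    (hb : b ∈ Set.Ioo 0 D) : ContinuousAt h b := by
  have h1 := hh.2.2.continuousOn_interior
  rw [interior_Icc] at h1
  have h2 : ContinuousAt (fun x => (h x ^ (1 / (N - 1))) ^ (N - 1)) b :=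
    (h1.continuousAt (Ioo_mem_nhds hb.1 hb.2)).rpow_const (Or.inr (by linarith))
  refine h2.congr ?_
  filter_upwards [Ioo_mem_nhds hb.1 hb.2] with x hx
  exact (IsCDDensity.pow_eq hN hh ⟨hx.1.le, hx.2.le⟩).symm

lemma essSup_le_perim {N D L : ℝ} {h : ℝ → ℝ} {E : Set ℝ} (hN : 1 < N)
    (hh : IsProbCDDensity N D h) (hE : E ⊆ Set.Icc 0 L)
    (d : IntervalDecomp D h E) (hw0 : 0 < ∫ x in E, h x)
    (hb : essSupSet E ∈ Set.Ioo 0 D) : h (essSupSet E) ≤ d.perim := by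
  obtain ⟨-, hle, hex⟩ := essSup_facts (N := N) hE d hw0
  by_contra hc
  push Not at hc
  have h1 := (IsCDDensity.continuousAt hN hh.1 hb).eventually (lt_mem_nhds hc)
  obtain ⟨δ, hδ, hball⟩ := Metric.eventually_nhds_iff.1 h1
  obtain ⟨i, hi, hit⟩ := hex (essSupSet E - δ) (by linarith)
  have h2 := hle i hi
  have h3 := hball (y := d.b i) (by rw [Real.dist_eq, abs_lt]; constructor <;> linarith)
  have h4 := right_le_perim hh d i hi (by linarith [hb.2])
  linarith

lemma mass_le_left {N D L : ℝ} {h : ℝ → ℝ} {E : Set ℝ}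
    (hh : IsProbCDDensity N D h) (hE : E ⊆ Set.Icc 0 L)
    (d : IntervalDecomp D h E) (hw0 : 0 < ∫ x in E, h x)
    (hb : essSupSet E ∈ Set.Ioo 0 D) :
    ∫ x in E, h x ≤ ∫ y in (0 : ℝ)..(essSupSet E), h y := by
  obtain ⟨-, hle, hex⟩ := essSup_facts (N := N) hE d hw0
  rw [setIntegral_congr_set d.aeEq, intervalIntegral.integral_of_le hb.1.le,
    ← integral_Icc_eq_integral_Ioc]
  have hsub : Set.Icc 0 (essSupSet E) ⊆ Set.Icc 0 D := Set.Icc_subset_Icc le_rfl hb.2.le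
  refine setIntegral_mono_set (hh.integrableOn.mono_set hsub) ?_ ?_
  · rw [Filter.EventuallyLE, ae_restrict_iff' measurableSet_Icc]
    exact Filter.Eventually.of_forall fun x hx => hh.1.1 x (hsub hx)
  · refine HasSubset.Subset.eventuallyLE (Set.iUnion_subset fun i x hx => ?_)
    exact ⟨(d.nonneg i).trans hx.1.le, hx.2.le.trans (hle i (hx.1.trans hx.2))⟩

lemma left_mass_small {N D b : ℝ} {h : ℝ → ℝ} (hN : 1 < N)
    (hh : IsProbCDDensity N D h) (hb : 0 < b) (hbD : 5 / 4 * b ≤ D) :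
    ∫ y in (0 : ℝ)..b, h y ≤ 5 ^ (N - 1) * (h b * D) := by
  have hb' : b ∈ Set.Ioo 0 D := ⟨hb, by linarith⟩
  have hD : 0 < D := hb.trans hb'.2
  obtain ⟨s, hs⟩ := exists_supergrad hh.1.2.2 hb'
  have hhb := IsCDDensity.pow_eq hN hh.1 ⟨hb.le, hb'.2.le⟩
  have hbn := hh.1.1 b ⟨hb.le, hb'.2.le⟩
  have hle : ∀ y ∈ Set.Icc 0 b, h y ≤ 5 ^ (N - 1) * h b := by
    intro y hy
    have hyI : y ∈ Set.Icc 0 D := ⟨hy.1, hy.2.trans hb'.2.le⟩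
    rw [IsCDDensity.pow_eq hN hh.1 hyI, hhb]
    have hβ := Real.rpow_nonneg hbn (1 / (N - 1))
    rw [← Real.mul_rpow (by norm_num) hβ]
    refine Real.rpow_le_rpow (Real.rpow_nonneg (hh.1.1 y hyI) _) ?_ (by linarith)
    have h1 := hs y hyI
    have h2 := hs D ⟨hD.le, le_rfl⟩
    have h3 := Real.rpow_nonneg (hh.1.1 D ⟨hD.le, le_rfl⟩) (1 / (N - 1))
    set β := h b ^ (1 / (N - 1))
    have h4 : s * (y - b) ≤ 4 * β := by
      rcases le_or_gt 0 s with h5 | h5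
      · nlinarith [hy.2]
      · nlinarith [hy.1]
    linarith
  have h1 : ∫ y in (0 : ℝ)..b, h y ≤ ∫ y in (0 : ℝ)..b, 5 ^ (N - 1) * h b :=
    intervalIntegral.integral_mono_on hb.le (hh.intervalIntegrable le_rfl hb.le hb'.2.le)
      (by simp) hle
  rw [intervalIntegral.integral_const, smul_eq_mul] at h1
  have h2 : (b - 0) * (5 ^ (N - 1) * h b) ≤ D * (5 ^ (N - 1) * h b) :=
    mul_le_mul_of_nonneg_right (by linarith [hb'.2]) (by positivity)
  linarith

lemma exists_rho {N κ : ℝ} (hN : 1 < N) (hκ : 0 < κ) :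
    ∃ ρ : ℝ, 0 < ρ ∧ (1 + ρ) ^ N ≤ (1 + κ) ^ N * (1 - ρ) := by
  have hc1 : Continuous fun ρ : ℝ => (1 + ρ) ^ N :=
    (by fun_prop : Continuous fun ρ : ℝ => 1 + ρ).rpow_const (fun _ => Or.inr (by linarith))
  have hc2 : Continuous fun ρ : ℝ => (1 + κ) ^ N * (1 - ρ) := by fun_prop
  have h0 : (1 + (0 : ℝ)) ^ N < (1 + κ) ^ N * (1 - 0) := by
    have := Real.one_lt_rpow (by linarith : 1 < 1 + κ) (by linarith : 0 < N)
    simpa using this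
  have h1 := (hc1.continuousAt (x := 0)).eventually_lt hc2.continuousAt h0
  obtain ⟨δ, hδ, hball⟩ := Metric.eventually_nhds_iff.1 h1
  refine ⟨δ / 2, by linarith, (hball ?_).le⟩
  rw [Real.dist_eq, sub_zero, abs_of_pos (by linarith)]
  linarith

lemma exists_delta {A : ℝ} (hA : A < 1) :
    ∃ δ : ℝ, 0 < δ ∧ δ ≤ 1 ∧ A * (1 + δ) * (1 + δ) < 1 := by
  have hc2 : Continuous fun δ : ℝ => A * (1 + δ) * (1 + δ) := by fun_prop
  have h1 := (hc2.continuousAt (x := 0)).eventually (gt_mem_nhds (by simpa using hA : _ < (1 : ℝ)))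
  obtain ⟨δ, hδ, hball⟩ := Metric.eventually_nhds_iff.1 h1
  refine ⟨min (δ / 2) 1, by positivity, min_le_right _ _, hball ?_⟩
  have : 0 < min (δ / 2) 1 := by positivity
  rw [Real.dist_eq, sub_zero, abs_of_pos this]
  linarith [min_le_left (δ / 2) 1]

lemma exists_wbar {θ η : ℝ} (hθ : 0 < θ) (hη : 0 < η) :
    ∃ w : ℝ, 0 < w ∧ w ≤ 1 / 6 ∧ w ^ θ ≤ η := by
  refine ⟨min (1 / 6) (η ^ θ⁻¹), by positivity, min_le_left _ _, ?_⟩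
  calc (min (1 / 6) (η ^ θ⁻¹)) ^ θ ≤ (η ^ θ⁻¹) ^ θ :=
        Real.rpow_le_rpow (by positivity) (min_le_right _ _) hθ.le
    _ = η := by rw [← Real.rpow_mul hη.le, inv_mul_cancel₀ hθ.ne', Real.rpow_one]

/-- Proposition 5.9 (almost rigidity of the density, upper bound): for small `m_h(E)` and
small residual, `h(x) ≤ h(b(E)) (x / b(E) + ε)^{N-1}` uniformly for `x ∈ [a(E), b(E)]`. -/
theorem density_upper_bound (N L : ℝ) (hN : 1 < N) (hL : 0 < L) :
    ∀ ε : ℝ, 0 < ε → ∃ wbar : ℝ, 0 < wbar ∧ ∃ δbar : ℝ, 0 < δbar ∧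
      ∀ D D' : ℝ, 3 * L ≤ D → D' ∈ Set.Ioc (0:ℝ) D →
      ∀ h : ℝ → ℝ, IsProbCDDensity N D' h →
      ∀ E : Set ℝ, E ⊆ Set.Icc 0 L →
      ∀ d : IntervalDecomp D' h E,
        0 < (∫ x in E, h x) → (∫ x in E, h x) ≤ wbar →
        D * d.perim / (N * (∫ x in E, h x) ^ (1 - 1 / N)) - 1 ≤ δbar →
        ∀ a : ℝ, IsRightmostStart E a →
        ∀ x ∈ Set.Icc a (essSupSet E),
          h x ≤ h (essSupSet E) * (x / essSupSet E + ε) ^ (N - 1) := by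
  intro ε' hε'
  have hN0 : 0 < N := by linarith
  have hN1 : 0 < N - 1 := by linarith
  have hθ : 0 < 1 - 1 / N := by
    rw [sub_pos, div_lt_one hN0]; exact hN
  -- shrink ε below one
  set ε := min ε' (1 / 2) with hεdef
  have hε : 0 < ε := by positivity
  have hε1 : ε < 1 := (min_le_right _ _).trans_lt (by norm_num)
  have hεN : 0 < ε ^ N := Real.rpow_pos_of_pos hε _
  have hεN1 : ε ^ N < 1 := Real.rpow_lt_one hε.le hε1 hN0
  have hA : (1 - ε ^ N) ^ (1 - 1 / N) < 1 := Real.rpow_lt_one (by linarith) (by linarith) hθ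
  have hA0 : 0 ≤ (1 - ε ^ N) ^ (1 - 1 / N) := Real.rpow_nonneg (by linarith) _
  obtain ⟨δ, hδ, hδ1, hAδ⟩ := exists_delta hA
  obtain ⟨ρ₁, hρ₁, hρκ₁⟩ := exists_rho hN (by norm_num : (0 : ℝ) < 1 / 10)
  obtain ⟨ρ₂, hρ₂, hρκ₂⟩ := exists_rho hN hδ
  obtain ⟨η₁, hη₁⟩ : ∃ η : ℝ, η = 1 / 3 * (ρ₁ / (1 + ρ₁)) ^ (N - 1) := ⟨_, rfl⟩
  obtain ⟨η₂, hη₂⟩ : ∃ η : ℝ, η = 1 / 3 * (ρ₂ / (1 + ρ₂)) ^ (N - 1) := ⟨_, rfl⟩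
  obtain ⟨η₃, hη₃⟩ : ∃ η : ℝ, η = 2 / 3 / 5 ^ (N - 1) := ⟨_, rfl⟩
  have p1 : 0 < η₁ := by rw [hη₁]; positivity
  have p2 : 0 < η₂ := by rw [hη₂]; positivity
  have p3 : 0 < η₃ := by rw [hη₃]; positivity
  obtain ⟨wbar, hw0, hw6, hwη⟩ := exists_wbar hθ
    (by positivity : 0 < min η₁ (min η₂ η₃) / (2 * N))
  rw [le_div_iff₀ (by positivity)] at hwη
  refine ⟨wbar, hw0, δ, hδ, ?_⟩
  intro D D' hDL hD' h hh E hE d hm0 hmw hres a ha x hx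
  have hD'0 : 0 < D' := hD'.1
  have hD : 0 < D := by linarith
  obtain ⟨w, hwdef⟩ : ∃ w : ℝ, w = ∫ x in E, h x := ⟨_, rfl⟩
  obtain ⟨b, hbdef⟩ : ∃ b : ℝ, b = essSupSet E := ⟨_, rfl⟩
  have hwθ : 0 < w ^ (1 - 1 / N) := by
    rw [hwdef]; exact Real.rpow_pos_of_pos hm0 _
  have hwle : w ^ (1 - 1 / N) ≤ wbar ^ (1 - 1 / N) :=
    Real.rpow_le_rpow (by rw [hwdef]; exact hm0.le) (by rw [hwdef]; exact hmw) hθ.le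
  have hP0 : 0 ≤ d.perim := tsum_nonneg fun j =>
    add_nonneg (perim_term_nonneg hh d j).1 (perim_term_nonneg hh d j).2
  have hP : D * d.perim ≤ (1 + δ) * (N * w ^ (1 - 1 / N)) := by
    rw [← hwdef, sub_le_iff_le_add, div_le_iff₀ (by positivity)] at hres
    linarith
  have hPη : d.perim * D ≤ min η₁ (min η₂ η₃) := by
    have : (1 + δ) * (N * w ^ (1 - 1 / N)) ≤ 2 * (N * wbar ^ (1 - 1 / N)) := by gcongr; linarith
    linarith
  have hPη' : d.perim * D' ≤ min η₁ (min η₂ η₃) :=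
    (mul_le_mul_of_nonneg_left hD'.2 hP0).trans hPη
  have m1 : min η₁ (min η₂ η₃) ≤ η₁ := min_le_left _ _
  have m2 : min η₁ (min η₂ η₃) ≤ η₂ := (min_le_right _ _).trans (min_le_left _ _)
  have m3 : min η₁ (min η₂ η₃) ≤ η₃ := (min_le_right _ _).trans (min_le_right _ _)
  -- Step 1: the diameter is not too small
  have hD'L : 5 / 4 * L ≤ D' := by
    by_contra hc
    push Not at hc
    have h1 := set_iso hN hD'0 hh d hρ₁ (by norm_num) hρκ₁ hm0 (hmw.trans hw6)
      (by rw [← hη₁]; exact hPη'.trans m1)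
    rw [← hwdef] at h1
    have h2 : D' * d.perim ≤ 5 / 12 * (D * d.perim) := by
      have : D' ≤ 5 / 12 * D := by linarith
      have := mul_le_mul_of_nonneg_right this hP0
      linarith
    have h3 : (1 + δ) * (N * w ^ (1 - 1 / N)) ≤ 2 * (N * w ^ (1 - 1 / N)) := by
      gcongr; linarith
    have h4 : (1 + 1 / 10) * (D' / N) * d.perim = 11 / 10 * (D' * d.perim) / N := by ring
    rw [h4, le_div_iff₀ hN0] at h1
    have h5 : 0 < N * w ^ (1 - 1 / N) := by positivity
    linarith
  -- Step 2
  have hx0 : 0 ≤ x := ha.1.trans hx.1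
  have hb0 : 0 < b := by rw [hbdef]; exact ha.1.trans_lt ha.2.1
  have hbL : b ≤ L := by rw [hbdef]; exact (essSup_facts (N := N) hE d hm0).1
  have hb : b ∈ Set.Ioo 0 D' := ⟨hb0, by linarith⟩
  have hhb : h b ≤ d.perim := by
    rw [hbdef] at hb ⊢
    exact essSup_le_perim hN hh hE d hm0 hb
  have hml : w ≤ ∫ y in (0 : ℝ)..b, h y := by
    rw [hbdef] at hb ⊢
    rw [hwdef]
    exact mass_le_left hh hE d hm0 hb
  have hxb : x ≤ b := by rw [hbdef]; exact hx.2
  rw [← hbdef]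
  have hbpos : 0 < h b := hh.1.2.1 b hb
  have hhbD : h b * D' ≤ min η₁ (min η₂ η₃) :=
    (mul_le_mul_of_nonneg_right hhb hD'0.le).trans hPη'
  have hxI : x ∈ Set.Icc 0 D' := ⟨hx0, hxb.trans hb.2.le⟩
  by_contra hc
  push Not at hc
  set β := h b ^ (1 / (N - 1)) with hβdef
  have hβ : 0 < β := Real.rpow_pos_of_pos hbpos _
  have hfx : β * (x / b + ε) < h x ^ (1 / (N - 1)) := by
    rw [IsCDDensity.pow_eq hN hh.1 hxI, IsCDDensity.pow_eq hN hh.1 ⟨hb.1.le, hb.2.le⟩, ← hβdef,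
      ← Real.mul_rpow hβ.le (by positivity)] at hc
    have h1 := (Real.rpow_lt_rpow_iff (by positivity)
      (Real.rpow_nonneg (hh.1.1 x hxI) _) hN1).1 hc
    refine lt_of_le_of_lt ?_ h1
    exact mul_le_mul_of_nonneg_left (by linarith [min_le_left ε' (1 / 2)]) hβ.le
  have hxlt : x < b := by
    refine lt_of_le_of_ne hxb ?_
    rintro rfl
    rw [div_self hb0.ne'] at hfx
    have : 0 < β * ε := by positivity
    linarith
  have key := half_left hN hh hb hε.le hε1 hρ₂ hδ hρκ₂ ?_ ?_
    (by rw [← hη₂]; exact hhbD.trans m2)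
  · have h1 : w ^ (1 - 1 / N) ≤ (∫ y in (0 : ℝ)..b, h y) ^ (1 - 1 / N) :=
      Real.rpow_le_rpow (by rw [hwdef]; exact hm0.le) hml hθ.le
    have h2 : D' / N * h b ≤ (1 + δ) * w ^ (1 - 1 / N) := by
      rw [div_mul_eq_mul_div, div_le_iff₀ hN0]
      have : D' * h b ≤ D * d.perim := mul_le_mul hD'.2 hhb hbpos.le hD.le
      linarith
    have h3 : (1 - ε ^ N) ^ (1 - 1 / N) * (1 + δ) * (D' / N * h b) ≤
        (1 - ε ^ N) ^ (1 - 1 / N) * (1 + δ) * ((1 + δ) * w ^ (1 - 1 / N)) :=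
      mul_le_mul_of_nonneg_left h2 (by positivity)
    have h4 : (1 - ε ^ N) ^ (1 - 1 / N) * (1 + δ) * (1 + δ) * w ^ (1 - 1 / N) <
        1 * w ^ (1 - 1 / N) := mul_lt_mul_of_pos_right hAδ hwθ
    linarith
  · intro s hs
    have h1 := hs x hxI
    rw [← hβdef] at h1 ⊢
    have h2 : s * (b - x) < β * (1 - x / b - ε) := by linarith
    -- multiply by b / (b - x)
    have h3 : s * b * (b - x) ≤ (1 - ε) * β * (b - x) := by
      have e : β * (1 - x / b - ε) * b = β * (b - x - ε * b) := by field_simp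
      have h4 := mul_lt_mul_of_pos_right h2 hb0
      rw [e] at h4
      have h5 : 0 ≤ β * ε * x := by positivity
      linarith
    have := le_of_mul_le_mul_right h3 (by linarith)
    linarith
  · have h1 := left_mass_small hN hh hb0 (by linarith)
    have h2 : (5 : ℝ) ^ (N - 1) * (h b * D') ≤ 5 ^ (N - 1) * η₃ :=
      mul_le_mul_of_nonneg_left (hhbD.trans m3) (by positivity)
    have h3 : (5 : ℝ) ^ (N - 1) * η₃ = 2 / 3 := by rw [hη₃]; field_simp
    linarith
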